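/- Let X be a countable commutative additive monoid, d, k ≥ 1 integers, p_{j,r} ∈ ℝ for j ∈ {1,…,k}, r ∈ {1,…,d}, λ_r ∈ (0,∞), U_r probability mass functions in ℓ¹(X), W_r = U_r − δ₀, R_j = Σ_{r=1}^d p_{j,r} W_r, G = exp(Σ_{r=1}^d λ_r W_r), and p_j = Σ_{r=1}^d |p_{j,r}|. With c_k = ((2k)!)^{1/(2k)}, it holds that ‖ (∏_{j=1}^k R_j^{*2}) * G ‖ ≤ √((2k)!) · ∏_{j=1}^k ( Σ_{r=1}^d |p_{j,r}| · min{ |p_{j,r}|/λ_r, (8/c_k)·p_j } ). -/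

import Mathlib

open scoped Classical BigOperators

noncomputable section

namespace PaperL1

variable {X : Type*} [AddCommMonoid X]

/-- Convolution of two summable functions on an additive commutative monoid:
`(f ⋆ g) x = Σ_{(y,z) : y + z = x} f y * g z`. -/
def conv (f g : X → ℝ) : X → ℝ :=
  fun x => ∑' p : {p : X × X // p.1 + p.2 = x}, f p.1.1 * g p.1.2

/-- The Dirac delta at a point: the unit of the convolution algebra is `delta 0`. -/
def delta (x₀ : X) : X → ℝ := fun x => if x = x₀ then 1 else 0

/-- Convolution powers, with `f^{*0} = δ₀`. -/
def convPow (f : X → ℝ) : ℕ → (X → ℝ)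
  | 0 => delta 0
  | n + 1 => conv f (convPow f n)

/-- The exponential in the convolution algebra: `exp f = Σ_m f^{*m}/m!`. -/
def convExp (f : X → ℝ) : X → ℝ :=
  fun x => ∑' m : ℕ, ((m.factorial : ℝ))⁻¹ * convPow f m x

/-- Convolution product over a finite (linearly ordered) index set; the empty
product is `δ₀`. -/
def convProd {ι : Type*} [LinearOrder ι] (s : Finset ι) (f : ι → X → ℝ) : X → ℝ :=
  (s.sort (· ≤ ·)).foldr (fun i acc => conv (f i) acc) (delta 0)

/-- The ℓ¹ norm: `‖f‖ = Σ_x |f x|`. -/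
def l1norm (f : X → ℝ) : ℝ := ∑' x, |f x|

/-- A probability mass function: nonnegative values summing to `1`. -/
def IsPmf (f : X → ℝ) : Prop := (∀ x, 0 ≤ f x) ∧ HasSum f 1

/-- The function `g(x) = 2 Σ_{m=2}^∞ (m-1) x^{m-2} / m!`. -/
def gfun (x : ℝ) : ℝ := ∑' m : ℕ, 2 * (m + 1) * x ^ m / ((m + 2).factorial : ℝ)

end PaperL1

open PaperL1

namespace PaperL1

section L1

set_option linter.unusedSectionVars false

variable {X : Type*} [AddCommMonoid X]

/-- pairing of an ℓ¹ function with a bounded function -/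
def pr (f φ : X → ℝ) : ℝ := ∑' x, f x * φ x

theorem summable_pr {f φ : X → ℝ} {C : ℝ} (hf : Summable f) (hφ : ∀ x, |φ x| ≤ C) :
    Summable (fun x => f x * φ x) := by
  refine Summable.of_norm_bounded (g := fun x => |f x| * C) (hf.abs.mul_right C) ?_
  intro x
  rw [Real.norm_eq_abs, abs_mul]
  exact mul_le_mul_of_nonneg_left (hφ x) (abs_nonneg _)

theorem abs_pr_le {f φ : X → ℝ} {C : ℝ} (hf : Summable f) (hφ : ∀ x, |φ x| ≤ C) :
    |pr f φ| ≤ l1norm f * C := by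
  unfold pr l1norm
  rw [← tsum_mul_right]
  refine (norm_tsum_le_tsum_norm (summable_pr hf hφ).norm).trans ?_
  refine (summable_pr hf hφ).norm.tsum_le_tsum ?_ (hf.abs.mul_right C)
  intro x
  rw [Real.norm_eq_abs, abs_mul]
  exact mul_le_mul_of_nonneg_left (hφ x) (abs_nonneg _)

theorem eq_of_pr {f g : X → ℝ} (h : ∀ φ : X → ℝ, (∀ x, |φ x| ≤ 1) → pr f φ = pr g φ) : f = g := by
  funext x
  have := h (fun y => if y = x then 1 else 0) (by intro y; split_ifs <;> simp)
  unfold pr at this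
  simpa using this

theorem l1norm_eq_pr (f : X → ℝ) : l1norm f = pr f (fun x => SignType.sign (f x)) := by
  unfold l1norm pr
  congr 1; funext x
  exact (self_mul_sign _).symm

theorem abs_sgn_le (f : X → ℝ) (x : X) : |((SignType.sign (f x) : SignType) : ℝ)| ≤ 1 := by
  rcases lt_trichotomy (f x) 0 with h | h | h <;> simp [h]

theorem hasSum_conv {f g φ : X → ℝ} {C : ℝ} (hf : Summable f) (hg : Summable g)
    (hφ : ∀ x, |φ x| ≤ C) :
    HasSum (fun x => conv f g x * φ x) (pr f (fun y => pr g (fun z => φ (y + z)))) := by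
  have h1 : Summable (fun p : X × X => f p.1 * g p.2) :=
    summable_mul_of_summable_norm hf.norm hg.norm
  have h2 : Summable (fun p : X × X => f p.1 * g p.2 * φ (p.1 + p.2)) :=
    summable_pr (φ := fun p : X × X => φ (p.1 + p.2)) h1 (fun p => hφ _)
  have e1 : ∑' p : X × X, f p.1 * g p.2 * φ (p.1 + p.2) =
      pr f (fun y => pr g (fun z => φ (y + z))) := by
    rw [h2.tsum_prod]
    unfold pr
    congr 1; funext y
    rw [← tsum_mul_left]
    congr 1; funext z
    ring
  rw [← e1]
  have h3 := h2.hasSum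
  rw [← (Equiv.sigmaFiberEquiv (fun p : X × X => p.1 + p.2)).hasSum_iff] at h3
  have h4 := h1
  rw [← (Equiv.sigmaFiberEquiv (fun p : X × X => p.1 + p.2)).summable_iff] at h4
  refine h3.sigma ?_
  intro x
  have h5 := (h4.sigma_factor x).hasSum.mul_right (φ x)
  have e5 : (fun p : {p : X × X // p.1 + p.2 = x} =>
      f p.1.1 * g p.1.2 * φ (p.1.1 + p.1.2)) = fun p => f p.1.1 * g p.1.2 * φ x := by
    funext p
    rw [p.2]
  have h6 : HasSum (fun p : {p : X × X // p.1 + p.2 = x} =>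
      f p.1.1 * g p.1.2 * φ (p.1.1 + p.1.2)) (conv f g x * φ x) := by
    rw [e5]; exact h5
  exact h6

theorem pr_conv {f g φ : X → ℝ} {C : ℝ} (hf : Summable f) (hg : Summable g)
    (hφ : ∀ x, |φ x| ≤ C) :
    pr (conv f g) φ = pr f (fun y => pr g (fun z => φ (y + z))) :=
  (hasSum_conv hf hg hφ).tsum_eq

theorem summable_conv {f g : X → ℝ} (hf : Summable f) (hg : Summable g) :
    Summable (conv f g) := by
  have := (hasSum_conv (φ := fun _ => 1) (C := 1) hf hg (by simp)).summable
  simpa using this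

theorem summable_delta (x : X) : Summable (delta x) := 
  summable_of_ne_finset_zero (s := {x}) (by intro b hb; simp at hb; simp [delta, hb])

theorem pr_delta (x : X) (φ : X → ℝ) : pr (delta x) φ = φ x := by
  simp [pr, delta]

theorem conv_comm (f g : X → ℝ) : conv f g = conv g f := by
  funext x
  let e : {p : X × X // p.1 + p.2 = x} ≃ {p : X × X // p.1 + p.2 = x} :=
    (Equiv.prodComm X X).subtypeEquiv (by intro p; simp [add_comm])
  unfold conv
  rw [← e.tsum_eq]
  congr 1; funext p
  simp [e, mul_comm]

theorem l1norm_conv_le {f g : X → ℝ} (hf : Summable f) (hg : Summable g) :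
    l1norm (conv f g) ≤ l1norm f * l1norm g := by
  rw [l1norm_eq_pr, pr_conv hf hg (abs_sgn_le _)]
  refine (le_abs_self _).trans ?_
  refine abs_pr_le hf (fun y => ?_)
  have := abs_pr_le hg (φ := fun z => ((SignType.sign (conv f g (y + z)) : SignType) : ℝ))
    (fun z => abs_sgn_le _ _)
  simpa using this

theorem conv_assoc {f g h : X → ℝ} (hf : Summable f) (hg : Summable g) (hh : Summable h) :
    conv (conv f g) h = conv f (conv g h) := by
  refine eq_of_pr (fun φ hφ => ?_)
  have hb : ∀ w, |pr h (fun z => φ (w + z))| ≤ l1norm h * 1 :=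
    fun w => abs_pr_le hh (fun z => hφ _)
  rw [pr_conv (summable_conv hf hg) hh hφ, pr_conv hf hg hb, pr_conv hf (summable_conv hg hh) hφ]
  congr 1; funext y
  rw [pr_conv hg hh (fun z => hφ (y + z))]
  simp only [add_assoc]

theorem delta_conv {f : X → ℝ} (hf : Summable f) : conv (delta 0) f = f := by
  refine eq_of_pr (fun φ hφ => ?_)
  rw [pr_conv (summable_delta 0) hf hφ, pr_delta]
  simp

theorem pr_add {f g φ : X → ℝ} {C : ℝ} (hf : Summable f) (hg : Summable g)
    (hφ : ∀ x, |φ x| ≤ C) : pr (f + g) φ = pr f φ + pr g φ := by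
  unfold pr
  rw [← (summable_pr hf hφ).tsum_add (summable_pr hg hφ)]
  simp [add_mul]

theorem pr_smul (c : ℝ) (f φ : X → ℝ) : pr (c • f) φ = c * pr f φ := by
  unfold pr
  rw [← tsum_mul_left]
  simp [mul_assoc]

theorem add_conv {f g h : X → ℝ} (hf : Summable f) (hg : Summable g) (hh : Summable h) :
    conv (f + g) h = conv f h + conv g h := by
  refine eq_of_pr (fun φ hφ => ?_)
  have hb : ∀ w, |pr h (fun z => φ (w + z))| ≤ l1norm h * 1 :=
    fun w => abs_pr_le hh (fun z => hφ _)
  rw [pr_conv (f := f + g) (hf.add hg) hh hφ, pr_add hf hg hb,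
    pr_add (summable_conv hf hh) (summable_conv hg hh) hφ, pr_conv hf hh hφ, pr_conv hg hh hφ]

theorem smul_conv (c : ℝ) {f h : X → ℝ} (hf : Summable f) (hh : Summable h) :
    conv (c • f) h = c • conv f h := by
  refine eq_of_pr (fun φ hφ => ?_)
  rw [pr_conv (f := c • f) (hf.mul_left c) hh hφ, pr_smul, pr_smul, pr_conv hf hh hφ]

/-- The Banach algebra ℓ¹(X). -/
def L1 (X : Type*) : Type _ := lp (fun _ : X => ℝ) 1

instance (X : Type*) : NormedAddCommGroup (L1 X) :=
  inferInstanceAs (NormedAddCommGroup (lp (fun _ : X => ℝ) 1))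
instance (X : Type*) : NormedSpace ℝ (L1 X) :=
  inferInstanceAs (NormedSpace ℝ (lp (fun _ : X => ℝ) 1))
instance (X : Type*) : CompleteSpace (L1 X) :=
  inferInstanceAs (CompleteSpace (lp (fun _ : X => ℝ) 1))

/-- underlying function -/
def L1.fn {X : Type*} (f : L1 X) : X → ℝ := (f : lp (fun _ : X => ℝ) 1).1

theorem memlp_iff {X : Type*} (f : X → ℝ) : Memℓp f 1 ↔ Summable f := by
  rw [memℓp_gen_iff (by simp)]
  simp [summable_abs_iff]

theorem L1.summable {X : Type*} (f : L1 X) : Summable f.fn := (memlp_iff _).1 f.2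

/-- constructor -/
def L1.mk {X : Type*} (f : X → ℝ) (hf : Summable f) : L1 X :=
  (⟨f, (memlp_iff f).2 hf⟩ : lp (fun _ : X => ℝ) 1)

@[simp] theorem L1.fn_mk {X : Type*} (f : X → ℝ) (hf : Summable f) : (L1.mk f hf).fn = f := rfl
@[simp] theorem L1.fn_add {X : Type*} (f g : L1 X) : (f + g).fn = f.fn + g.fn := rfl
@[simp] theorem L1.fn_sub {X : Type*} (f g : L1 X) : (f - g).fn = f.fn - g.fn := rfl
@[simp] theorem L1.fn_smul {X : Type*} (c : ℝ) (f : L1 X) : (c • f).fn = c • f.fn := rfl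
@[simp] theorem L1.fn_zero {X : Type*} : (0 : L1 X).fn = 0 := rfl
theorem L1.ext {X : Type*} {f g : L1 X} (h : f.fn = g.fn) : f = g := Subtype.ext h

theorem L1.norm_eq {X : Type*} (f : L1 X) : ‖f‖ = l1norm f.fn := by
  have := lp.norm_eq_tsum_rpow (p := 1) (by simp) (f : lp (fun _ : X => ℝ) 1)
  simp at this
  exact this

instance : NormedCommRing (L1 X) :=
  { (inferInstance : NormedAddCommGroup (L1 X)) with
    mul := fun f g => L1.mk (conv f.fn g.fn) (summable_conv f.summable g.summable)
    one := L1.mk (delta 0) (summable_delta 0)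
    mul_assoc := fun f g h => L1.ext (conv_assoc f.summable g.summable h.summable)
    mul_comm := fun f g => L1.ext (conv_comm _ _)
    one_mul := fun f => L1.ext (delta_conv f.summable)
    mul_one := fun f => L1.ext ((conv_comm _ _).trans (delta_conv f.summable))
    left_distrib := fun f g h => L1.ext (by
      show conv f.fn (g.fn + h.fn) = conv f.fn g.fn + conv f.fn h.fn
      rw [conv_comm, add_conv g.summable h.summable f.summable, conv_comm g.fn, conv_comm h.fn])
    right_distrib := fun f g h => L1.ext (add_conv f.summable g.summable h.summable)
    zero_mul := fun f => L1.ext (by funext x; show conv (0 : X → ℝ) f.fn x = 0; simp [conv])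
    mul_zero := fun f => L1.ext (by funext x; show conv f.fn (0 : X → ℝ) x = 0; simp [conv])
    norm_mul_le := fun f g => by
      have := l1norm_conv_le f.summable g.summable
      rw [L1.norm_eq, L1.norm_eq, L1.norm_eq]
      exact this }

@[simp] theorem L1.fn_mul (f g : L1 X) : (f * g).fn = conv f.fn g.fn := rfl
@[simp] theorem L1.fn_one : (1 : L1 X).fn = delta 0 := rfl

instance : NormedAlgebra ℝ (L1 X) :=
  { Algebra.ofModule (fun c f g => L1.ext (by
        show conv (c • f.fn) g.fn = c • conv f.fn g.fn
        exact smul_conv c f.summable g.summable))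
      (fun c f g => L1.ext (by
        show conv f.fn (c • g.fn) = c • conv f.fn g.fn
        rw [conv_comm, smul_conv c g.summable f.summable, conv_comm])) with
    norm_smul_le := fun c f => norm_smul_le c f }

instance : NormOneClass (L1 X) where
  norm_one := by
    rw [L1.norm_eq, L1.fn_one]
    have : l1norm (delta (0:X)) = pr (delta (0:X)) (fun _ => 1) := by
      unfold l1norm pr delta
      congr 1; funext x; split_ifs <;> simp
    rw [this, pr_delta]

theorem L1.fn_pow (f : L1 X) (n : ℕ) : (f ^ n).fn = convPow f.fn n := by
  induction n with
  | zero => rfl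
  | succ n ih => rw [pow_succ', L1.fn_mul, ih]; rfl

theorem L1.fn_sum {ι : Type*} (s : Finset ι) (f : ι → L1 X) :
    (∑ i ∈ s, f i).fn = ∑ i ∈ s, (f i).fn := by
  induction s using Finset.induction_on with
  | empty => simp
  | insert a s ha ih => rw [Finset.sum_insert ha, Finset.sum_insert ha, L1.fn_add, ih]

theorem L1.fn_exp (f G : L1 X) (h : HasSum (fun m : ℕ => ((m.factorial : ℝ))⁻¹ • f ^ m) G) :
    G.fn = convExp f.fn := by
  funext x
  have hc : Continuous (fun f : L1 X => f.fn x) := 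
    (lp.evalCLM ℝ (fun _ : X => ℝ) 1 x).continuous
  let ev : L1 X →+ ℝ := ⟨⟨fun f => f.fn x, rfl⟩, fun f g => rfl⟩
  have := h.map ev hc
  unfold convExp
  have h2 : G.fn x = _ := this.tsum_eq.symm
  rw [h2]
  congr 1; funext m
  show ((m.factorial : ℝ)⁻¹ • (f ^ m).fn) x = _
  rw [L1.fn_pow]
  rfl

theorem L1.fn_prod {k : ℕ} (f : Fin k → L1 X) :
    (∏ j, f j).fn = convProd Finset.univ (fun j => (f j).fn) := by
  have h : ∀ l : List (Fin k), ((l.map f).prod).fn =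
      l.foldr (fun i acc => conv ((f i).fn) acc) (delta 0) := by
    intro l
    induction l with
    | nil => rfl
    | cons a l ih => simp [ih]
  unfold convProd
  rw [← h, ← Multiset.prod_coe, ← Multiset.map_coe, Finset.sort_eq]
  rfl

end L1

end PaperL1

namespace PaperL1

section Fock

variable {d : ℕ}

theorem summable_pi {a : Fin d → ℕ → ℝ} (h0 : ∀ r n, 0 ≤ a r n) (hs : ∀ r, Summable (a r)) :
    Summable (fun n : Fin d → ℕ => ∏ r, a r (n r)) := by
  refine summable_of_sum_le (c := ∏ r, ∑' m, a r m)
    (fun n => Finset.prod_nonneg (fun r _ => h0 r _)) ?_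
  intro s
  have hsub : s ⊆ Fintype.piFinset (fun r => s.image (fun n => n r)) := by
    intro n hn
    rw [Fintype.mem_piFinset]
    intro r
    exact Finset.mem_image_of_mem _ hn
  refine (Finset.sum_le_sum_of_subset_of_nonneg hsub
    (fun n _ _ => Finset.prod_nonneg (fun r _ => h0 r _))).trans ?_
  rw [← Finset.prod_univ_sum]
  refine Finset.prod_le_prod (fun r _ => Finset.sum_nonneg (fun m _ => h0 r m)) ?_
  intro r _
  exact (hs r).sum_le_tsum _ (fun m _ => h0 r m)

theorem tendsto_box : Filter.Tendsto
    (fun N : ℕ => Fintype.piFinset (fun _ : Fin d => Finset.range N)) Filter.atTop Filter.atTop := by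
  refine Filter.tendsto_atTop_finset_of_monotone ?_ ?_
  · intro M N h
    exact Fintype.piFinset_subset _ _ (fun _ => Finset.range_mono h)
  · intro n
    refine ⟨∑ r, n r + 1, ?_⟩
    rw [Fintype.mem_piFinset]
    intro r
    rw [Finset.mem_range]
    exact Nat.lt_succ_of_le (Finset.single_le_sum (f := n) (fun _ _ => Nat.zero_le _) (Finset.mem_univ r))

theorem hasSum_pi {A : Type*} [NormedCommRing A] [NormOneClass A] [CompleteSpace A]
    {u : Fin d → ℕ → A} {s : Fin d → A} (hn : ∀ r, Summable (fun m => ‖u r m‖))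
    (hs : ∀ r, HasSum (u r) (s r)) :
    HasSum (fun n : Fin d → ℕ => ∏ r, u r (n r)) (∏ r, s r) := by
  have h1 : Summable (fun n : Fin d → ℕ => ∏ r, u r (n r)) := by
    refine Summable.of_norm_bounded (summable_pi (fun r n => norm_nonneg _) hn) ?_
    intro n
    exact Finset.norm_prod_le _ _
  have h2 := h1.hasSum.comp tendsto_box
  have h3 : Filter.Tendsto (fun N : ℕ => ∏ r, ∑ m ∈ Finset.range N, u r m) Filter.atTop
      (nhds (∏ r, s r)) :=
    tendsto_finsetProd _ (fun r _ => (hs r).tendsto_sum_nat)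
  have h4 : (fun N : ℕ => ∏ r, ∑ m ∈ Finset.range N, u r m) =
      ((fun s : Finset (Fin d → ℕ) => ∑ n ∈ s, ∏ r, u r (n r)) ∘
        fun N : ℕ => Fintype.piFinset (fun _ : Fin d => Finset.range N)) := by
    funext N
    simp only [Function.comp]
    rw [Finset.prod_univ_sum]
  rw [h4] at h3
  have h5 := tendsto_nhds_unique h2 h3
  rw [← h5]
  exact h1.hasSum

/-- product Poisson weights -/
def pw (lam : Fin d → ℝ) (n : Fin d → ℕ) : ℝ :=
  ∏ r, (Real.exp (-lam r) * (((n r).factorial : ℝ)⁻¹ * lam r ^ n r))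

theorem pw_nonneg {lam : Fin d → ℝ} (hl : ∀ r, 0 < lam r) (n : Fin d → ℕ) : 0 ≤ pw lam n :=
  Finset.prod_nonneg (fun r _ => by have := hl r; positivity)

theorem pw_succ {lam : Fin d → ℝ} (hl : ∀ r, 0 < lam r) (n : Fin d → ℕ) (r : Fin d) :
    pw lam (n + Pi.single r 1) * (((n + Pi.single r 1 : Fin d → ℕ) r : ℕ) / lam r) = pw lam n := by
  unfold pw
  rw [← Finset.mul_prod_erase _ _ (Finset.mem_univ r), ← Finset.mul_prod_erase _ _ (Finset.mem_univ r)]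
  have : ∀ s ∈ Finset.univ.erase r, (Real.exp (-lam s) * ((((n + Pi.single r 1 : Fin d → ℕ) s).factorial : ℝ)⁻¹
      * lam s ^ (n + Pi.single r 1 : Fin d → ℕ) s)) =
      (Real.exp (-lam s) * (((n s).factorial : ℝ)⁻¹ * lam s ^ n s)) := by
    intro s hs
    have hs' := Finset.ne_of_mem_erase hs
    simp [hs']
  rw [Finset.prod_congr rfl this]
  have h0 := (hl r).ne'
  have h1 : ((n r + 1).factorial : ℝ) = (n r + 1) * (n r).factorial := by
    rw [Nat.factorial_succ]; push_cast; ring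
  have h2 : ((n r).factorial : ℝ) ≠ 0 := by positivity
  have h3 : (n r + 1 : ℝ) ≠ 0 := by positivity
  simp only [Pi.add_apply, Pi.single_eq_same, h1]
  push_cast
  rw [pow_succ]
  field_simp

/-- functions of at most exponential growth -/
def Gr (d : ℕ) : Submodule ℝ ((Fin d → ℕ) → ℝ) where
  carrier := {h | ∃ C t : ℝ, 0 ≤ C ∧ 1 ≤ t ∧ ∀ n, |h n| ≤ C * ∏ r, t ^ n r}
  zero_mem' := ⟨0, 1, le_rfl, le_rfl, by simp⟩
  add_mem' := by
    rintro f g ⟨C, t, hC, ht, hf⟩ ⟨C', t', hC', ht', hg⟩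
    refine ⟨C + C', t * t', by positivity, one_le_mul_of_one_le_of_one_le ht ht', ?_⟩
    intro n
    have h1 : ∏ r, t ^ n r ≤ ∏ r, (t * t') ^ n r :=
      Finset.prod_le_prod (fun r _ => by positivity) (fun r _ => by
        gcongr; nlinarith)
    have h2 : ∏ r, t' ^ n r ≤ ∏ r, (t * t') ^ n r :=
      Finset.prod_le_prod (fun r _ => by positivity) (fun r _ => by
        gcongr; nlinarith)
    calc |f n + g n| ≤ |f n| + |g n| := abs_add_le _ _
      _ ≤ C * ∏ r, t ^ n r + C' * ∏ r, t' ^ n r := add_le_add (hf n) (hg n)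
      _ ≤ C * ∏ r, (t * t') ^ n r + C' * ∏ r, (t * t') ^ n r := by gcongr
      _ = _ := by ring
  smul_mem' := by
    rintro c f ⟨C, t, hC, ht, hf⟩
    refine ⟨|c| * C, t, by positivity, ht, ?_⟩
    intro n
    simp only [Pi.smul_apply, smul_eq_mul, abs_mul]
    rw [mul_assoc]
    exact mul_le_mul_of_nonneg_left (hf n) (abs_nonneg _)

theorem mem_Gr {h : (Fin d → ℕ) → ℝ} :
    h ∈ Gr d ↔ ∃ C t : ℝ, 0 ≤ C ∧ 1 ≤ t ∧ ∀ n, |h n| ≤ C * ∏ r, t ^ n r := Iff.rfl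

theorem Gr_mul {f g : (Fin d → ℕ) → ℝ} (hf : f ∈ Gr d) (hg : g ∈ Gr d) : f * g ∈ Gr d := by
  obtain ⟨C, t, hC, ht, hf⟩ := hf
  obtain ⟨C', t', hC', ht', hg⟩ := hg
  refine ⟨C * C', t * t', by positivity, one_le_mul_of_one_le_of_one_le ht ht', ?_⟩
  intro n
  simp only [Pi.mul_apply, abs_mul, mul_pow, Finset.prod_mul_distrib]
  calc |f n| * |g n| ≤ (C * ∏ r, t ^ n r) * (C' * ∏ r, t' ^ n r) :=
        mul_le_mul (hf n) (hg n) (abs_nonneg _) ((abs_nonneg _).trans (hf n))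
    _ = _ := by ring

theorem Gr_const (c : ℝ) : (fun _ => c) ∈ Gr d := ⟨|c|, 1, abs_nonneg _, le_rfl, by simp⟩

theorem Gr_one : (1 : (Fin d → ℕ) → ℝ) ∈ Gr d := Gr_const 1

theorem Gr_abs {f : (Fin d → ℕ) → ℝ} (hf : f ∈ Gr d) : (fun n => |f n|) ∈ Gr d := by
  obtain ⟨C, t, hC, ht, hf⟩ := hf
  exact ⟨C, t, hC, ht, by simpa using hf⟩

theorem Gr_coord (r : Fin d) : (fun n : Fin d → ℕ => (n r : ℝ)) ∈ Gr d := by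
  refine ⟨1, 2, by norm_num, by norm_num, ?_⟩
  intro n
  rw [one_mul, abs_of_nonneg (by positivity)]
  have h1 : (n r : ℝ) ≤ 2 ^ n r := by exact_mod_cast (Nat.lt_two_pow_self).le
  refine h1.trans ?_
  rw [← Finset.mul_prod_erase _ _ (Finset.mem_univ r)]
  refine le_mul_of_one_le_right (by positivity) ?_
  have h2 : ∏ s ∈ Finset.univ.erase r, (1 : ℝ) ≤ ∏ s ∈ Finset.univ.erase r, (2 : ℝ) ^ n s :=
    Finset.prod_le_prod (fun s _ => by norm_num) (fun s _ => one_le_pow₀ (by norm_num))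
  simpa using h2

theorem Gr_up (r : Fin d) {f : (Fin d → ℕ) → ℝ} (hf : f ∈ Gr d) :
    (fun n => f (n + Pi.single r 1)) ∈ Gr d := by
  obtain ⟨C, t, hC, ht, hf⟩ := hf
  refine ⟨C * ∏ s, t ^ (Pi.single r 1 : Fin d → ℕ) s, t, by positivity, ht, ?_⟩
  intro n
  refine (hf _).trans (le_of_eq ?_)
  simp only [Pi.add_apply, pow_add, Finset.prod_mul_distrib]
  ring

theorem Gr_down (r : Fin d) {f : (Fin d → ℕ) → ℝ} (hf : f ∈ Gr d) :
    (fun n => f (n - Pi.single r 1)) ∈ Gr d := by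
  obtain ⟨C, t, hC, ht, hf⟩ := hf
  refine ⟨C, t, by positivity, ht, ?_⟩
  intro n
  refine (hf _).trans ?_
  refine mul_le_mul_of_nonneg_left ?_ hC
  refine Finset.prod_le_prod (fun r _ => by positivity) (fun s _ => ?_)
  exact pow_le_pow_right₀ ht (Nat.sub_le _ _)

theorem summable_Gr {lam : Fin d → ℝ} (hl : ∀ r, 0 < lam r) {h : (Fin d → ℕ) → ℝ} (hh : h ∈ Gr d) :
    Summable (fun n => pw lam n * h n) := by
  obtain ⟨C, t, hC, ht, hf⟩ := hh
  have h1 : Summable (fun n : Fin d → ℕ =>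
      ∏ r, (Real.exp (-lam r) * ((t * lam r) ^ n r / ((n r).factorial : ℝ)))) := by
    refine summable_pi (a := fun r m => Real.exp (-lam r) * ((t * lam r) ^ m / (m.factorial : ℝ)))
      (fun r m => ?_) (fun r => ?_)
    · have := hl r
      positivity
    · exact (Real.summable_pow_div_factorial _).mul_left _
  refine Summable.of_norm_bounded (h1.mul_left C) ?_
  intro n
  rw [Real.norm_eq_abs, abs_mul, abs_of_nonneg (pw_nonneg hl n)]
  refine (mul_le_mul_of_nonneg_left (hf n) (pw_nonneg hl n)).trans (le_of_eq ?_)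
  unfold pw
  rw [mul_left_comm, ← Finset.prod_mul_distrib]
  congr 1
  refine Finset.prod_congr rfl (fun r _ => ?_)
  rw [mul_pow]
  ring

/-- expectation -/
def Ex (lam : Fin d → ℝ) (h : (Fin d → ℕ) → ℝ) : ℝ := ∑' n, pw lam n * h n


theorem Ex_add {lam : Fin d → ℝ} (hl : ∀ r, 0 < lam r) {f g : (Fin d → ℕ) → ℝ} (hf : f ∈ Gr d) (hg : g ∈ Gr d) :
    Ex lam (f + g) = Ex lam f + Ex lam g := by
  unfold Ex
  rw [← (summable_Gr hl hf).tsum_add (summable_Gr hl hg)]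
  simp [mul_add]

theorem Ex_mono {lam : Fin d → ℝ} (hl : ∀ r, 0 < lam r) {f g : (Fin d → ℕ) → ℝ} (hf : f ∈ Gr d) (hg : g ∈ Gr d) (h : ∀ n, f n ≤ g n) :
    Ex lam f ≤ Ex lam g :=
  (summable_Gr hl hf).tsum_le_tsum (fun n => mul_le_mul_of_nonneg_left (h n) (pw_nonneg hl n))
    (summable_Gr hl hg)

theorem Ex_smul (lam : Fin d → ℝ) (c : ℝ) (f : (Fin d → ℕ) → ℝ) :
    Ex lam (c • f) = c * Ex lam f := by
  unfold Ex
  rw [← tsum_mul_left]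
  congr 1; funext n
  simp; ring

theorem Ex_sum {lam : Fin d → ℝ} (hl : ∀ r, 0 < lam r) {ι : Type*} (s : Finset ι)
    (f : ι → (Fin d → ℕ) → ℝ)
    (hf : ∀ i, f i ∈ Gr d) : Ex lam (∑ i ∈ s, f i) = ∑ i ∈ s, Ex lam (f i) := by
  induction s using Finset.induction_on with
  | empty => simp [Ex]
  | insert a s ha ih =>
    rw [Finset.sum_insert ha, Finset.sum_insert ha, Ex_add hl (hf a) (Submodule.sum_mem _ (fun i _ => hf i)), ih]

theorem hasSum_shift {E : Type*} [NormedAddCommGroup E] [NormedSpace ℝ E] 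
    {lam : Fin d → ℝ} (hl : ∀ r, 0 < lam r) (r : Fin d) (v : (Fin d → ℕ) → E) (a : E) :
    HasSum (fun n => pw lam n • v (n + Pi.single r 1)) a ↔
    HasSum (fun n => (pw lam n * ((n r : ℝ) / lam r)) • v n) a := by
  have hinj : Function.Injective (fun n : Fin d → ℕ => n + Pi.single r 1) :=
    fun m n h => by simpa using h
  rw [← hinj.hasSum_iff (f := fun n => (pw lam n * ((n r : ℝ) / lam r)) • v n)]
  · have : (fun n => pw lam n • v (n + Pi.single r 1)) = (fun n => (pw lam n * ((n r : ℝ) / lam r)) • v n) ∘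
        (fun n : Fin d → ℕ => n + Pi.single r 1) := by
      funext n
      simp only [Function.comp]
      rw [pw_succ hl]
    rw [this]
  · intro n hn
    have : n r = 0 := by
      by_contra h
      apply hn
      refine ⟨n - Pi.single r 1, ?_⟩
      funext s
      by_cases hs : s = r
      · subst hs; simp; omega
      · simp [hs]
    simp [this]

/-- creation operator -/
def Dc (lam : Fin d → ℝ) (r : Fin d) : Module.End ℝ ((Fin d → ℕ) → ℝ) where
  toFun h := fun n => (n r : ℝ) / lam r * h (n - Pi.single r 1) - h n
  map_add' f g := by funext n; simp; ring
  map_smul' c f := by funext n; simp; ring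

/-- annihilation operator -/
def Nb (r : Fin d) : Module.End ℝ ((Fin d → ℕ) → ℝ) where
  toFun h := fun n => h (n + Pi.single r 1) - h n
  map_add' f g := by funext n; simp; ring
  map_smul' c f := by funext n; simp; ring

theorem Dc_Gr (lam : Fin d → ℝ) (r : Fin d) {h} (hh : h ∈ Gr d) : Dc lam r h ∈ Gr d := by
  have h1 := Gr_mul ((Gr d).smul_mem (lam r)⁻¹ (Gr_coord r)) (Gr_down r hh)
  have h2 := (Gr d).sub_mem h1 hh
  convert h2 using 1
  funext n
  simp [Dc]
  ring

theorem Nb_Gr (r : Fin d) {h : (Fin d → ℕ) → ℝ} (hh : h ∈ Gr d) : Nb r h ∈ Gr d :=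
  (Gr d).sub_mem (Gr_up r hh) hh

theorem Ex_Dc {lam : Fin d → ℝ} (hl : ∀ r, 0 < lam r) (r : Fin d) {h g : (Fin d → ℕ) → ℝ}
    (hh : h ∈ Gr d) (hg : g ∈ Gr d) : Ex lam (Dc lam r h * g) = Ex lam (h * Nb r g) := by
  have hG1 : (fun n => h n * g (n + Pi.single r 1)) ∈ Gr d := Gr_mul hh (Gr_up r hg)
  have h0' : HasSum (fun n => pw lam n * (h n * g (n + Pi.single r 1)))
      (Ex lam (fun n => h n * g (n + Pi.single r 1))) := (summable_Gr hl hG1).hasSum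
  have h1 := (hasSum_shift hl r (fun n => h (n - Pi.single r 1) * g n)
    (Ex lam (fun n => h n * g (n + Pi.single r 1)))).1 (by
      simp only [add_tsub_cancel_right, smul_eq_mul]
      exact h0')
  have h0 : HasSum (fun n => pw lam n * (h * g) n) (Ex lam (h * g)) :=
    (summable_Gr hl (Gr_mul hh hg)).hasSum
  have h2 := h1.sub h0
  have h3 := h0'.sub h0
  have e2 : (fun n => pw lam n * (Dc lam r h * g) n) = fun n =>
      (pw lam n * ((n r : ℝ) / lam r)) • (h (n - Pi.single r 1) * g n) - pw lam n * (h * g) n := by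
    funext n
    simp [Dc]
    ring
  have e3 : (fun n => pw lam n * (h * Nb r g) n) = fun n =>
      pw lam n * (h n * g (n + Pi.single r 1)) - pw lam n * (h * g) n := by
    funext n
    simp [Nb]
    ring
  have f2 : Ex lam (Dc lam r h * g) = Ex lam (fun n => h n * g (n + Pi.single r 1)) - Ex lam (h * g) := by
    rw [← h2.tsum_eq, ← e2, Ex]
  have f3 : Ex lam (h * Nb r g) = Ex lam (fun n => h n * g (n + Pi.single r 1)) - Ex lam (h * g) := by
    rw [← h3.tsum_eq, ← e3, Ex]
  rw [f2, f3]

theorem Dc_comm (lam : Fin d → ℝ) (r s : Fin d) : Dc lam r * Dc lam s = Dc lam s * Dc lam r := by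
  by_cases hrs : r = s
  · rw [hrs]
  have hsr : s ≠ r := Ne.symm hrs
  ext1 h
  funext n
  have : n - Pi.single r 1 - Pi.single s 1 = n - Pi.single s 1 - (Pi.single r 1 : Fin d → ℕ) := by
    funext i; simp; omega
  simp [Dc, this, hrs, hsr]
  ring

theorem Nb_Dc {lam : Fin d → ℝ} (hl : ∀ r, 0 < lam r) (r s : Fin d) :
    Nb r * Dc lam s = Dc lam s * Nb r + (if r = s then (lam r)⁻¹ else 0) • 1 := by
  ext1 h
  funext n
  by_cases hrs : r = s
  · subst hrs
    by_cases h0 : n r = 0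
    · have := (hl r).ne'
      simp [Nb, Dc, h0]
      ring
    · have h1 : n - Pi.single r 1 + (Pi.single r 1 : Fin d → ℕ) = n := by
        funext i
        by_cases hi : i = r
        · subst hi; simp; omega
        · simp [hi]
      have := (hl r).ne'
      simp [Nb, Dc, h1]
      ring
  · have hsr : s ≠ r := Ne.symm hrs
    by_cases h0 : n s = 0
    · simp [Nb, Dc, hrs, hsr, h0]
      ring
    · have h1 : n + Pi.single r 1 - Pi.single s 1 = n - Pi.single s 1 + (Pi.single r 1 : Fin d → ℕ) := by
        funext i
        by_cases hi : i = s
        · subst hi; simp [hsr]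
        · simp [hi]
      simp [Nb, Dc, hrs, hsr, h1]
      ring

/-- smeared operators -/
def Dq (lam q : Fin d → ℝ) : Module.End ℝ ((Fin d → ℕ) → ℝ) := ∑ r, q r • Dc lam r
/-- smeared annihilation -/
def Nq (q : Fin d → ℝ) : Module.End ℝ ((Fin d → ℕ) → ℝ) := ∑ r, q r • Nb r
/-- number operator -/
def Num (lam : Fin d → ℝ) : Module.End ℝ ((Fin d → ℕ) → ℝ) := ∑ r, lam r • (Dc lam r * Nb r)

theorem Num_Dq {lam : Fin d → ℝ} (hl : ∀ r, 0 < lam r) (q : Fin d → ℝ) :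
    Num lam * Dq lam q = Dq lam q * Num lam + Dq lam q := by
  have h1 : ∀ r s, Dc lam r * Nb r * Dc lam s = Dc lam s * (Dc lam r * Nb r) +
      (if r = s then (lam r)⁻¹ else 0) • Dc lam r := by
    intro r s
    rw [mul_assoc, Nb_Dc hl, mul_add, ← mul_assoc, Dc_comm lam r s, mul_assoc]
    simp
  have e1 : Num lam * Dq lam q = ∑ s, ∑ r, (lam r * q s) • (Dc lam r * Nb r * Dc lam s) := by
    unfold Num Dq
    rw [Finset.sum_mul_sum, Finset.sum_comm]
    simp only [smul_mul_smul_comm]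
  have e2 : Dq lam q * Num lam = ∑ s, ∑ r, (lam r * q s) • (Dc lam s * (Dc lam r * Nb r)) := by
    unfold Num Dq
    rw [Finset.sum_mul_sum]
    refine Finset.sum_congr rfl (fun s _ => Finset.sum_congr rfl (fun r _ => ?_))
    rw [smul_mul_smul_comm, mul_comm (q s)]
  rw [e1, e2]
  simp only [h1, smul_add, Finset.sum_add_distrib]
  congr 1
  unfold Dq
  refine Finset.sum_congr rfl (fun s _ => ?_)
  rw [Finset.sum_eq_single s]
  · have := (hl s).ne'
    rw [if_pos rfl, smul_smul]
    congr 1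
    field_simp
  · intro r _ hr
    simp [hr]
  · simp

theorem Nq_Dq {lam : Fin d → ℝ} (hl : ∀ r, 0 < lam r) (q : Fin d → ℝ) :
    Nq q * Dq lam q = Dq lam q * Nq q + (∑ r, q r ^ 2 / lam r) • 1 := by
  have e1 : Nq q * Dq lam q = ∑ s, ∑ r, (q r * q s) • (Nb r * Dc lam s) := by
    unfold Nq Dq
    rw [Finset.sum_mul_sum, Finset.sum_comm]
    simp only [smul_mul_smul_comm]
  have e2 : Dq lam q * Nq q = ∑ s, ∑ r, (q r * q s) • (Dc lam s * Nb r) := by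
    unfold Nq Dq
    rw [Finset.sum_mul_sum]
    refine Finset.sum_congr rfl (fun s _ => Finset.sum_congr rfl (fun r _ => ?_))
    rw [smul_mul_smul_comm, mul_comm (q s)]
  rw [e1, e2]
  simp only [Nb_Dc hl, smul_add, Finset.sum_add_distrib, Finset.sum_smul]
  congr 1
  refine Finset.sum_congr rfl (fun s _ => ?_)
  rw [Finset.sum_eq_single s]
  · rw [if_pos rfl, smul_smul]
    congr 1
    ring
  · intro r _ hr
    simp [hr]
  · simp

theorem Dq_Gr (lam q : Fin d → ℝ) {h : (Fin d → ℕ) → ℝ} (hh : h ∈ Gr d) : Dq lam q h ∈ Gr d := by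
  unfold Dq
  rw [LinearMap.sum_apply]
  exact Submodule.sum_mem _ (fun r _ => (Gr d).smul_mem _ (Dc_Gr lam r hh))

theorem Nq_Gr (q : Fin d → ℝ) {h : (Fin d → ℕ) → ℝ} (hh : h ∈ Gr d) : Nq q h ∈ Gr d := by
  unfold Nq
  rw [LinearMap.sum_apply]
  exact Submodule.sum_mem _ (fun r _ => (Gr d).smul_mem _ (Nb_Gr r hh))

theorem Ex_Dq {lam : Fin d → ℝ} (hl : ∀ r, 0 < lam r) (q : Fin d → ℝ) {h g : (Fin d → ℕ) → ℝ}
    (hh : h ∈ Gr d) (hg : g ∈ Gr d) : Ex lam (Dq lam q h * g) = Ex lam (h * Nq q g) := by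
  have e1 : Dq lam q h * g = ∑ r, q r • (Dc lam r h * g) := by
    unfold Dq
    rw [LinearMap.sum_apply, Finset.sum_mul]
    simp
  have e2 : h * Nq q g = ∑ r, q r • (h * Nb r g) := by
    unfold Nq
    rw [LinearMap.sum_apply, Finset.mul_sum]
    simp
  rw [e1, e2, Ex_sum hl _ _ (fun r => (Gr d).smul_mem _ (Gr_mul (Dc_Gr lam r hh) hg)),
    Ex_sum hl _ _ (fun r => (Gr d).smul_mem _ (Gr_mul hh (Nb_Gr r hg)))]
  refine Finset.sum_congr rfl (fun r _ => ?_)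
  rw [Ex_smul, Ex_smul, Ex_Dc hl r hh hg]

theorem Ex_Nq_le {lam : Fin d → ℝ} (hl : ∀ r, 0 < lam r) (q : Fin d → ℝ) {h : (Fin d → ℕ) → ℝ}
    (hh : h ∈ Gr d) (m : ℝ) (hm : Num lam h = m • h) :
    Ex lam (Nq q h * Nq q h) ≤ (∑ r, q r ^ 2 / lam r) * (m * Ex lam (h * h)) := by
  have e1 : Ex lam (∑ r, lam r • (Nb r h * Nb r h)) = m * Ex lam (h * h) := by
    have hG : ∀ r, lam r • (Nb r h * Nb r h) ∈ Gr d :=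
      fun r => (Gr d).smul_mem _ (Gr_mul (Nb_Gr r hh) (Nb_Gr r hh))
    have hG' : ∀ r, lam r • (Dc lam r (Nb r h) * h) ∈ Gr d :=
      fun r => (Gr d).smul_mem _ (Gr_mul (Dc_Gr lam r (Nb_Gr r hh)) hh)
    rw [Ex_sum hl _ _ hG]
    have : ∀ r, Ex lam (lam r • (Nb r h * Nb r h)) = Ex lam (lam r • (Dc lam r (Nb r h) * h)) := by
      intro r
      rw [Ex_smul, Ex_smul, Ex_Dc hl r (Nb_Gr r hh) hh]
    simp only [this]
    rw [← Ex_sum hl _ _ hG', ← Ex_smul]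
    congr 1
    rw [← smul_mul_assoc, ← hm]
    unfold Num
    rw [LinearMap.sum_apply, Finset.sum_mul]
    simp
  rw [← e1, ← Ex_smul]
  refine Ex_mono hl (Gr_mul (Nq_Gr q hh) (Nq_Gr q hh)) ((Gr d).smul_mem _ (Submodule.sum_mem _
    (fun r _ => (Gr d).smul_mem _ (Gr_mul (Nb_Gr r hh) (Nb_Gr r hh))))) ?_
  intro n
  have := Finset.sum_mul_sq_le_sq_mul_sq Finset.univ (fun r => q r / Real.sqrt (lam r))
    (fun r => Real.sqrt (lam r) * Nb r h n)
  have a1 : ∀ r, q r / Real.sqrt (lam r) * (Real.sqrt (lam r) * Nb r h n) = q r * Nb r h n := by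
    intro r
    have := (Real.sqrt_pos.2 (hl r)).ne'
    field_simp
  have a2 : ∀ r, (q r / Real.sqrt (lam r)) ^ 2 = q r ^ 2 / lam r := by
    intro r
    rw [div_pow, Real.sq_sqrt (hl r).le]
  have a3 : ∀ r, (Real.sqrt (lam r) * Nb r h n) ^ 2 = lam r * (Nb r h n * Nb r h n) := by
    intro r
    rw [mul_pow, Real.sq_sqrt (hl r).le]; ring
  simp only [a1, a2, a3] at this
  have b1 : (Nq q h) n = ∑ r, q r * Nb r h n := by
    unfold Nq
    rw [LinearMap.sum_apply, Finset.sum_apply]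
    simp
  simp only [Pi.mul_apply, Pi.smul_apply, smul_eq_mul, Finset.sum_apply, b1]
  rw [← sq]
  exact this

theorem Ex_Dq_le {lam : Fin d → ℝ} (hl : ∀ r, 0 < lam r) (q : Fin d → ℝ) {h : (Fin d → ℕ) → ℝ}
    (hh : h ∈ Gr d) (m : ℝ) (hm : Num lam h = m • h) :
    Ex lam (Dq lam q h * Dq lam q h) ≤ (m + 1) * (∑ r, q r ^ 2 / lam r) * Ex lam (h * h) := by
  rw [Ex_Dq hl q hh (Dq_Gr lam q hh)]
  have h1 : Nq q (Dq lam q h) = Dq lam q (Nq q h) + (∑ r, q r ^ 2 / lam r) • h := by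
    have := congrArg (fun T : Module.End ℝ ((Fin d → ℕ) → ℝ) => T h) (Nq_Dq hl q)
    simpa using this
  rw [h1, mul_add, Ex_add hl (Gr_mul hh (Dq_Gr lam q (Nq_Gr q hh)))
    (Gr_mul hh ((Gr d).smul_mem _ hh)), mul_comm h, Ex_Dq hl q (Nq_Gr q hh) hh, mul_smul_comm, Ex_smul]
  have := Ex_Nq_le hl q hh m hm
  linarith

end Fock

end PaperL1

namespace PaperL1

section Abstract

set_option linter.unusedSectionVars false

variable {d : ℕ} {A : Type*} [NormedCommRing A] [NormOneClass A] [CompleteSpace A]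
  [NormedAlgebra ℝ A]

/-- monomials -/
def Mon {d : ℕ} {A : Type*} [NormedCommRing A] (U : Fin d → A) (n : Fin d → ℕ) : A :=
  ∏ r, U r ^ n r

theorem norm_Mon_le {U : Fin d → A} (hU : ∀ r, ‖U r‖ ≤ 1) (n : Fin d → ℕ) : ‖Mon U n‖ ≤ 1 := by
  unfold Mon
  refine (Finset.norm_prod_le _ _).trans ?_
  refine Finset.prod_le_one (fun r _ => norm_nonneg _) (fun r _ => ?_)
  exact (norm_pow_le _ _).trans (pow_le_one₀ (norm_nonneg _) (hU r))

theorem Mon_succ (U : Fin d → A) (n : Fin d → ℕ) (r : Fin d) :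
    Mon U (n + Pi.single r 1) = U r * Mon U n := by
  unfold Mon
  simp only [Pi.add_apply, pow_add, Finset.prod_mul_distrib]
  rw [mul_comm]
  congr 1
  rw [Finset.prod_eq_single r]
  · simp
  · intro s _ hs
    simp [hs]
  · simp

theorem hasSum_Dc {lam : Fin d → ℝ} (hl : ∀ r, 0 < lam r) (U : Fin d → A) (r : Fin d)
    {h : (Fin d → ℕ) → ℝ} {a : A} (ha : HasSum (fun n => (pw lam n * h n) • Mon U n) a) :
    HasSum (fun n => (pw lam n * Dc lam r h n) • Mon U n) ((U r - 1) * a) := by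
  have h1 := (hasSum_shift hl r (fun n => h (n - Pi.single r 1) • Mon U n) (U r * a)).1 (by
    have := ha.mul_left (U r)
    simp only [add_tsub_cancel_right, Mon_succ, smul_smul]
    simpa only [mul_smul_comm] using this)
  have h2 := h1.sub ha
  have e : (fun n => (pw lam n * Dc lam r h n) • Mon U n) = fun n =>
      (pw lam n * ((n r : ℝ) / lam r)) • (h (n - Pi.single r 1) • Mon U n) -
        (pw lam n * h n) • Mon U n := by
    funext n
    rw [smul_smul, ← sub_smul]
    congr 1
    simp [Dc]
    ring
  rw [e, sub_mul, one_mul]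
  exact h2

theorem hasSum_Dq {lam : Fin d → ℝ} (hl : ∀ r, 0 < lam r) (U : Fin d → A) (q : Fin d → ℝ)
    {h : (Fin d → ℕ) → ℝ} {a : A} (ha : HasSum (fun n => (pw lam n * h n) • Mon U n) a) :
    HasSum (fun n => (pw lam n * Dq lam q h n) • Mon U n) ((∑ r, q r • (U r - 1)) * a) := by
  have h1 := hasSum_sum (s := Finset.univ)
    (fun r (_ : r ∈ Finset.univ) => (hasSum_Dc hl U r ha).const_smul (q r))
  have e : (fun n => (pw lam n * Dq lam q h n) • Mon U n) = fun n =>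
      ∑ r, q r • ((pw lam n * Dc lam r h n) • Mon U n) := by
    funext n
    simp only [smul_smul]
    rw [← Finset.sum_smul]
    congr 1
    unfold Dq
    rw [LinearMap.sum_apply, Finset.sum_apply, Finset.mul_sum]
    refine Finset.sum_congr rfl (fun r _ => ?_)
    simp
    ring
  rw [e, Finset.sum_mul]
  simpa only [smul_mul_assoc] using h1

theorem hasSum_exp {lam : Fin d → ℝ} (U : Fin d → A) {G : A}
    (hG : HasSum (fun m : ℕ => ((m.factorial : ℝ))⁻¹ • (∑ r, lam r • (U r - 1)) ^ m) G) :
    HasSum (fun n => (pw lam n * (1 : (Fin d → ℕ) → ℝ) n) • Mon U n) G := by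
  let _ : NormedAlgebra ℚ A := NormedAlgebra.restrictScalars ℚ ℝ A
  have h1 : G = NormedSpace.exp (∑ r, lam r • (U r - 1)) :=
    hG.unique (NormedSpace.exp_series_hasSum_exp' (𝕂 := ℝ) _)
  rw [NormedSpace.exp_sum] at h1
  have h2 : ∀ r, HasSum (fun m : ℕ => (Real.exp (-lam r) * ((m.factorial : ℝ)⁻¹ * lam r ^ m)) • U r ^ m)
      (NormedSpace.exp (lam r • (U r - 1))) := by
    intro r
    have e1 : lam r • (U r - 1) = algebraMap ℝ A (-lam r) + lam r • U r := by
      rw [Algebra.algebraMap_eq_smul_one, smul_sub, neg_smul]; abel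
    rw [e1, NormedSpace.exp_add, ← NormedSpace.algebraMap_exp_comm, ← Real.exp_eq_exp_ℝ]
    have := (NormedSpace.exp_series_hasSum_exp' (𝕂 := ℝ) (lam r • U r)).mul_left
      (algebraMap ℝ A (Real.exp (-lam r)))
    have e : (fun m : ℕ => (Real.exp (-lam r) * ((m.factorial : ℝ)⁻¹ * lam r ^ m)) • U r ^ m) =
        fun m : ℕ => algebraMap ℝ A (Real.exp (-lam r)) * (m.factorial : ℝ)⁻¹ • (lam r • U r) ^ m := by
      funext m
      rw [← Algebra.smul_def, smul_pow, smul_smul, smul_smul, mul_assoc]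
    rw [e]
    exact this
  have h3 : ∀ r, Summable (fun m : ℕ =>
      ‖(Real.exp (-lam r) * ((m.factorial : ℝ)⁻¹ * lam r ^ m)) • U r ^ m‖) := by
    intro r
    have := (NormedSpace.norm_expSeries_summable' (𝕂 := ℝ) (lam r • U r)).mul_left
      (Real.exp (-lam r))
    have e : (fun m : ℕ => ‖(Real.exp (-lam r) * ((m.factorial : ℝ)⁻¹ * lam r ^ m)) • U r ^ m‖) =
        fun m : ℕ => Real.exp (-lam r) * ‖(m.factorial : ℝ)⁻¹ • (lam r • U r) ^ m‖ := by
      funext m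
      rw [smul_pow, smul_smul, mul_smul, norm_smul, Real.norm_eq_abs, Real.abs_exp]
    rw [e]
    exact this
  rw [h1]
  convert hasSum_pi h3 h2 using 1
  funext n
  simp only [Pi.one_apply, mul_one]
  unfold pw Mon
  rw [Finset.prod_smul]

theorem Ex_one {lam : Fin d → ℝ} : Ex lam (1 : (Fin d → ℕ) → ℝ) = 1 := by
  have := hasSum_exp (A := ℝ) (lam := lam) (fun _ => 1) (G := 1) (by
    have h := hasSum_single
      (f := fun m : ℕ => ((m.factorial : ℝ))⁻¹ • (∑ r : Fin d, lam r • ((1 : ℝ) - 1)) ^ m) 0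
      (by intro m hm; simp [hm])
    have e : ((Nat.factorial 0 : ℝ))⁻¹ • (∑ r : Fin d, lam r • ((1 : ℝ) - 1)) ^ 0 = 1 := by simp
    rw [e] at h
    exact h)
  unfold Ex
  rw [← this.tsum_eq]
  simp [Mon]

theorem Ex_abs_le {lam : Fin d → ℝ} (hl : ∀ r, 0 < lam r) {h : (Fin d → ℕ) → ℝ} (hh : h ∈ Gr d) :
    Ex lam (fun n => |h n|) ^ 2 ≤ Ex lam (h * h) := by
  set M := Ex lam (fun n => |h n|) with hM
  have hhh := Gr_mul hh hh
  have ha := Gr_abs hh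
  have h1 : Ex lam (h * h + ((-2 * M) • (fun n => |h n|) + (M ^ 2) • 1)) =
      Ex lam (h * h) + ((-2 * M) * M + M ^ 2 * 1) := by
    rw [Ex_add hl hhh ((Gr d).add_mem ((Gr d).smul_mem _ ha) ((Gr d).smul_mem _ Gr_one)),
      Ex_add hl ((Gr d).smul_mem _ ha) ((Gr d).smul_mem _ Gr_one), Ex_smul, Ex_smul, Ex_one, hM]
  have h2 : 0 ≤ Ex lam (h * h + ((-2 * M) • (fun n => |h n|) + (M ^ 2) • 1)) := by
    refine tsum_nonneg (fun n => mul_nonneg (pw_nonneg hl n) ?_)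
    have := sq_nonneg (|h n| - M)
    simp only [Pi.add_apply, Pi.mul_apply, Pi.smul_apply, smul_eq_mul, Pi.one_apply]
    nlinarith [sq_abs (h n)]
  rw [h1] at h2
  linarith

/-- `a` is represented by a homogeneous Charlier function of degree `n` with controlled norm. -/
def St (lam : Fin d → ℝ) (U : Fin d → A) (n : ℕ) (a : A) (M : ℝ) : Prop :=
  ∃ h ∈ Gr d, Num lam h = (n : ℝ) • h ∧ HasSum (fun n => (pw lam n * h n) • Mon U n) a ∧
    Ex lam (h * h) ≤ (n.factorial : ℝ) * M

theorem St_norm {lam : Fin d → ℝ} (hl : ∀ r, 0 < lam r) {U : Fin d → A} (hU : ∀ r, ‖U r‖ ≤ 1)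
    {n : ℕ} {a : A} {M : ℝ} (h : St lam U n a M) : ‖a‖ ≤ Real.sqrt (n.factorial * M) := by
  obtain ⟨h, hh, -, hs, hE⟩ := h
  refine Real.le_sqrt_of_sq_le (le_trans ?_ hE)
  refine le_trans ?_ (Ex_abs_le hl hh)
  refine pow_le_pow_left₀ (norm_nonneg _) ?_ 2
  rw [← hs.tsum_eq]
  refine tsum_of_norm_bounded (summable_Gr hl (Gr_abs hh)).hasSum ?_
  intro n
  rw [norm_smul, Real.norm_eq_abs, abs_mul, abs_of_nonneg (pw_nonneg hl n)]
  exact mul_le_of_le_one_right (mul_nonneg (pw_nonneg hl n) (abs_nonneg _)) (norm_Mon_le hU n)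

theorem St_step {lam : Fin d → ℝ} (hl : ∀ r, 0 < lam r) {U : Fin d → A}
    {n : ℕ} {a : A} {M : ℝ} (h : St lam U n a M) (q : Fin d → ℝ) :
    St lam U (n + 1) ((∑ r, q r • (U r - 1)) * a) ((∑ r, q r ^ 2 / lam r) * M) := by
  obtain ⟨h, hh, hN, hs, hE⟩ := h
  refine ⟨Dq lam q h, Dq_Gr lam q hh, ?_, hasSum_Dq hl U q hs, ?_⟩
  · have := congrArg (fun T : Module.End ℝ ((Fin d → ℕ) → ℝ) => T h) (Num_Dq hl q)
    simp only [Module.End.mul_apply, LinearMap.add_apply, hN, map_smul] at this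
    rw [this]
    push_cast
    rw [add_smul, one_smul]
  · refine (Ex_Dq_le hl q hh n hN).trans ?_
    have hq : 0 ≤ ∑ r, q r ^ 2 / lam r :=
      Finset.sum_nonneg (fun r _ => div_nonneg (sq_nonneg _) (hl r).le)
    have : ((n + 1).factorial : ℝ) = (n + 1) * n.factorial := by
      rw [Nat.factorial_succ]; push_cast; ring
    rw [this]
    calc ((n : ℝ) + 1) * (∑ r, q r ^ 2 / lam r) * Ex lam (h * h)
        ≤ ((n : ℝ) + 1) * (∑ r, q r ^ 2 / lam r) * (n.factorial * M) :=
          mul_le_mul_of_nonneg_left hE (by positivity)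
      _ = _ := by ring

theorem St_base {lam : Fin d → ℝ} (U : Fin d → A) {G : A}
    (hG : HasSum (fun m : ℕ => ((m.factorial : ℝ))⁻¹ • (∑ r, lam r • (U r - 1)) ^ m) G) :
    St lam U 0 G 1 := by
  refine ⟨1, Gr_one, ?_, hasSum_exp U hG, ?_⟩
  · have : ∀ r : Fin d, Nb r (1 : (Fin d → ℕ) → ℝ) = 0 := by
      intro r; funext n; simp [Nb]
    simp [Num, LinearMap.sum_apply, this]
  · rw [mul_one, Ex_one]; simp

theorem St_prod {lam : Fin d → ℝ} (hl : ∀ r, 0 < lam r) (U : Fin d → A) {G : A}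
    (hG : HasSum (fun m : ℕ => ((m.factorial : ℝ))⁻¹ • (∑ r, lam r • (U r - 1)) ^ m) G)
    {ι : Type*} (q : ι → Fin d → ℝ) (t : Finset ι) :
    St lam U (2 * t.card) ((∏ j ∈ t, (∑ r, q j r • (U r - 1)) ^ 2) * G)
      ((∏ j ∈ t, ∑ r, q j r ^ 2 / lam r) ^ 2) := by
  induction t using Finset.induction_on with
  | empty => simpa using St_base U hG
  | insert j t hj ih =>
    have := St_step hl (St_step hl ih (q j)) (q j)
    rw [Finset.card_insert_of_notMem hj, Finset.prod_insert hj, Finset.prod_insert hj]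
    convert this using 1
    · ring
    · ring
    · generalize (∏ j ∈ t, ∑ r, q j r ^ 2 / lam r) = P
      generalize (∑ r, q j r ^ 2 / lam r) = Q
      ring

theorem factorial_pow_le (m j : ℕ) : m.factorial ^ (m + j) ≤ (m + j).factorial ^ m := by
  induction j with
  | zero => simp
  | succ j ih =>
    rw [← add_assoc, pow_succ, Nat.factorial_succ, mul_pow, mul_comm]
    refine Nat.mul_le_mul ?_ ih
    calc m.factorial ≤ m ^ m := Nat.factorial_le_pow m
      _ ≤ _ := Nat.pow_le_pow_left (by omega) m

theorem abstract_main (k : ℕ) (hk : 1 ≤ k) {lam : Fin d → ℝ} (hl : ∀ r, 0 < lam r)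
    (U : Fin d → A) (hU : ∀ r, ‖U r‖ ≤ 1) {G : A}
    (hG : HasSum (fun m : ℕ => ((m.factorial : ℝ))⁻¹ • (∑ r, lam r • (U r - 1)) ^ m) G)
    (p : Fin k → Fin d → ℝ) (c : ℝ) (hc : 0 < c) (hck : c ^ (2 * k) = ((2 * k).factorial : ℝ)) :
    ‖(∏ j, (∑ r, p j r • (U r - 1)) ^ 2) * G‖ ≤ Real.sqrt ((2 * k).factorial : ℝ) *
      ∏ j, (∑ r, |p j r| * min (|p j r| / lam r) (8 / c * ∑ r, |p j r|)) := by
  have hsq : Real.sqrt ((2 * k).factorial : ℝ) = c ^ k := by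
    rw [← hck, mul_comm, pow_mul, Real.sqrt_sq (by positivity)]
  have hfac : ∀ s, s ≤ k → Real.sqrt ((2 * s).factorial : ℝ) ≤ c ^ s := by
    intro s hs
    rw [Real.sqrt_le_left (by positivity), ← pow_mul]
    have h1 := factorial_pow_le (2 * s) (2 * k - 2 * s)
    rw [show 2 * s + (2 * k - 2 * s) = 2 * k by omega] at h1
    have h2 : ((2 * s).factorial : ℝ) ^ (2 * k) ≤ ((2 * k).factorial : ℝ) ^ (2 * s) := by
      exact_mod_cast h1
    rw [← hck, ← pow_mul] at h2
    refine le_of_pow_le_pow_left₀ (n := 2 * k) (by omega) (by positivity) (h2.trans (le_of_eq ?_))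
    rw [← pow_mul]
    congr 1
    ring
  set pa : Fin k → ℝ := fun j => ∑ r, |p j r| with hpa
  have hpa0 : ∀ j, 0 ≤ pa j := fun j => Finset.sum_nonneg (fun r _ => abs_nonneg _)
  let q : Fin k → Fin d → ℝ := fun j r => if |p j r| / lam r ≤ 8 / c * pa j then p j r else 0
  let b : Fin k → ℝ := fun j => ∑ r, |p j r - q j r|
  let a : Fin k → ℝ := fun j => ∑ r, q j r ^ 2 / lam r
  let AA : Fin k → A := fun j => ∑ r, q j r • (U r - 1)
  let BB : Fin k → A := fun j => ∑ r, (p j r - q j r) • (U r - 1)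
  let CC : Fin k → A := fun j => ∑ r, (p j r + q j r) • (U r - 1)
  have ha0 : ∀ j, 0 ≤ a j := fun j => Finset.sum_nonneg (fun r _ => div_nonneg (sq_nonneg _) (hl r).le)
  have hb0 : ∀ j, 0 ≤ b j := fun j => Finset.sum_nonneg (fun r _ => abs_nonneg _)
  have hW : ∀ r, ‖U r - 1‖ ≤ 2 := by
    intro r
    refine (norm_sub_le _ _).trans ?_
    rw [norm_one]
    linarith [hU r]
  have hsum : ∀ v : Fin d → ℝ, ‖∑ r, v r • (U r - 1)‖ ≤ 2 * ∑ r, |v r| := by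
    intro v
    refine (norm_sum_le _ _).trans ?_
    rw [Finset.mul_sum]
    refine Finset.sum_le_sum (fun r _ => ?_)
    rw [norm_smul, Real.norm_eq_abs, mul_comm]
    exact mul_le_mul_of_nonneg_right (hW r) (abs_nonneg _)
  have hE : ∀ j, ‖BB j * CC j‖ ≤ 8 * b j * pa j := by
    intro j
    have h1 : ‖BB j‖ ≤ 2 * b j := hsum _
    have h2 : ‖CC j‖ ≤ 2 * (2 * pa j) := by
      refine (hsum _).trans ?_
      rw [hpa]
      refine mul_le_mul_of_nonneg_left ?_ (by norm_num)
      rw [Finset.mul_sum]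
      refine Finset.sum_le_sum (fun r _ => ?_)
      simp only [q]
      split_ifs
      · rw [← two_mul, abs_mul]; simp
      · rw [add_zero]; linarith [abs_nonneg (p j r)]
    calc ‖BB j * CC j‖ ≤ ‖BB j‖ * ‖CC j‖ := norm_mul_le _ _
      _ ≤ (2 * b j) * (2 * (2 * pa j)) :=
        mul_le_mul h1 h2 (norm_nonneg _) (by have := hb0 j; positivity)
      _ = _ := by ring
  have hdec : ∀ j, (∑ r, p j r • (U r - 1)) ^ 2 = AA j ^ 2 + BB j * CC j := by
    intro j
    have e1 : BB j = (∑ r, p j r • (U r - 1)) - AA j := by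
      simp only [BB, AA, sub_smul, Finset.sum_sub_distrib]
    have e2 : CC j = (∑ r, p j r • (U r - 1)) + AA j := by
      simp only [CC, AA, add_smul, Finset.sum_add_distrib]
    rw [e1, e2]
    ring
  have hrhs : ∀ j, (∑ r, |p j r| * min (|p j r| / lam r) (8 / c * pa j)) =
      a j + 8 * b j * pa j / c := by
    intro j
    have : 8 * b j * pa j / c = ∑ r, |p j r - q j r| * (8 / c * pa j) := by
      rw [← Finset.sum_mul]; ring
    rw [this, ← Finset.sum_add_distrib]
    refine Finset.sum_congr rfl (fun r _ => ?_)
    simp only [q]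
    split_ifs with h
    · rw [min_eq_left h, sub_self, abs_zero, zero_mul, add_zero, ← sq_abs]
      ring
    · rw [min_eq_right (not_le.1 h).le]
      simp
  have hrhs' : (∏ j, ∑ r, |p j r| * min (|p j r| / lam r) (8 / c * ∑ r, |p j r|)) =
      ∏ j, (a j + 8 * b j * pa j / c) := Finset.prod_congr rfl (fun j _ => hrhs j)
  rw [hrhs']
  simp only [hdec]
  rw [hsq, Finset.prod_add, Finset.sum_mul, Finset.prod_add, Finset.mul_sum]
  refine (norm_sum_le _ _).trans (Finset.sum_le_sum (fun t ht => ?_))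
  have htk : t.card ≤ k := by simpa using Finset.card_le_univ t
  have hSt := St_norm hl hU (St_prod hl U hG q t)
  rw [Real.sqrt_mul (by positivity), Real.sqrt_sq (Finset.prod_nonneg (fun j _ => ha0 j))] at hSt
  have hR : ‖∏ j ∈ Finset.univ \ t, BB j * CC j‖ ≤ ∏ j ∈ Finset.univ \ t, (8 * b j * pa j) :=
    (Finset.norm_prod_le _ _).trans
      (Finset.prod_le_prod (fun j _ => norm_nonneg _) (fun j _ => hE j))
  have hcard : (Finset.univ \ t).card = k - t.card := by
    rw [Finset.card_sdiff_of_subset (Finset.subset_univ _)]; simp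
  have hP : 0 ≤ ∏ j ∈ t, a j := Finset.prod_nonneg (fun j _ => ha0 j)
  calc ‖(∏ j ∈ t, AA j ^ 2) * (∏ j ∈ Finset.univ \ t, BB j * CC j) * G‖
      = ‖((∏ j ∈ t, AA j ^ 2) * G) * (∏ j ∈ Finset.univ \ t, BB j * CC j)‖ := by
        congr 1; ring
    _ ≤ ‖(∏ j ∈ t, AA j ^ 2) * G‖ * ‖∏ j ∈ Finset.univ \ t, BB j * CC j‖ := norm_mul_le _ _
    _ ≤ (c ^ t.card * ∏ j ∈ t, a j) * ∏ j ∈ Finset.univ \ t, (8 * b j * pa j) :=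
        mul_le_mul (hSt.trans (mul_le_mul_of_nonneg_right (hfac _ htk) hP)) hR (norm_nonneg _)
          (by positivity)
    _ = _ := by
      rw [Finset.prod_div_distrib, Finset.prod_const, hcard]
      have : c ^ k = c ^ t.card * c ^ (k - t.card) := by
        rw [← pow_add]; congr 1; omega
      rw [this]
      have h0 : c ^ (k - t.card) ≠ 0 := by positivity
      field_simp

end Abstract

end PaperL1

/-- Lemma 4.3 of Roos (special case `u = 0`, `w_j = c_k/2`):
`‖(Π_j R_j²) G‖ ≤ √((2k)!) Π_j (Σ_r |p_{j,r}| min{|p_{j,r}|/λ_r, (8/c_k) p_j})`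
with `c_k = ((2k)!)^{1/(2k)}`. -/
theorem smoothness_estimate_squares_special
    {X : Type*} [AddCommMonoid X] [Countable X]
    (d k : ℕ) (hd : 1 ≤ d) (hk : 1 ≤ k)
    (p : Fin k → Fin d → ℝ) (lam : Fin d → ℝ) (hlam : ∀ r, 0 < lam r)
    (U : Fin d → X → ℝ) (hU : ∀ r, IsPmf (U r))
    (W : Fin d → X → ℝ) (hW : ∀ r, W r = U r - delta 0)
    (R : Fin k → X → ℝ) (hR : ∀ j, R j = ∑ r, p j r • W r)
    (G : X → ℝ) (hG : G = convExp (∑ r, lam r • W r))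
    (pa : Fin k → ℝ) (hpa : ∀ j, pa j = ∑ r, |p j r|)
    (ck : ℝ) (hck : ck = ((2 * k).factorial : ℝ) ^ ((1:ℝ) / (2 * k))) :
    l1norm (conv (convProd Finset.univ (fun j => conv (R j) (R j))) G) ≤
      Real.sqrt ((2 * k).factorial : ℝ) *
        ∏ j, (∑ r, |p j r| * min (|p j r| / lam r) (8 / ck * pa j)) := by
  let U' : Fin d → L1 X := fun r => L1.mk (U r) (hU r).2.summable
  have hU' : ∀ r, ‖U' r‖ ≤ 1 := by
    intro r
    rw [L1.norm_eq]
    show l1norm (U r) ≤ 1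
    unfold l1norm
    have : (fun x => |U r x|) = U r := by
      funext x; exact abs_of_nonneg ((hU r).1 x)
    rw [this, (hU r).2.tsum_eq]
  have hlin : ∀ v : Fin d → ℝ, (∑ r, v r • (U' r - 1)).fn = ∑ r, v r • W r := by
    intro v
    rw [L1.fn_sum]
    refine Finset.sum_congr rfl (fun r _ => ?_)
    rw [hW r]
    rfl
  have hsum : HasSum (fun m : ℕ => ((m.factorial : ℝ))⁻¹ • (∑ r, lam r • (U' r - 1)) ^ m)
      (∑' m : ℕ, ((m.factorial : ℝ))⁻¹ • (∑ r, lam r • (U' r - 1)) ^ m) :=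
    (NormedSpace.expSeries_summable' (𝕂 := ℝ) _).hasSum
  have hGfn := L1.fn_exp _ _ hsum
  rw [hlin, ← hG] at hGfn
  have hc0 : (0 : ℝ) < ((2 * k).factorial : ℝ) := by positivity
  have hc : 0 < ck := by rw [hck]; positivity
  have hcp : ck ^ (2 * k) = ((2 * k).factorial : ℝ) := by
    rw [hck, ← Real.rpow_natCast, ← Real.rpow_mul hc0.le]
    have hk' : (k : ℝ) ≠ 0 := by
      have : k ≠ 0 := by omega
      exact_mod_cast this
    have : (1 : ℝ) / (2 * k) * ((2 * k : ℕ) : ℝ) = 1 := by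
      push_cast
      field_simp
    rw [this, Real.rpow_one]
  have key := abstract_main k hk hlam U' hU' hsum p ck hc hcp
  rw [L1.norm_eq, L1.fn_mul, hGfn, L1.fn_prod] at key
  simp only [sq, L1.fn_mul, hlin, ← hR] at key
  simpa only [hpa] using key
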